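/- Let a < 0, and define φ(x) = −(3/2)·sech²(x/(2√(−a))) and φ_a(x) = (3x/(4(−a)^{3/2}))·sech²(x/(2√(−a)))·tanh(x/(2√(−a))). Then the following Lebesgue integrals over ℝ hold: ∫φ² = 6√(−a); ∫(φ')² = 6/(5√(−a)); ∫(φ'')² = 6/(7(−a)^{3/2}); ∫φ·φ'' = −6/(5√(−a)); ∫φ_a·φ = −3/(2√(−a)); ∫φ_a·φ'' = −3/(10(−a)^{3/2}). -/

import Mathlib

open MeasureTheory

open Filter Topology in
theorem tendsto_inv_one_add_sq_atTop :
    Tendsto (fun x : ℝ => (1 + x ^ 2)⁻¹) atTop (𝓝 0) :=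
  (tendsto_atTop_add_const_left _ _ (tendsto_pow_atTop two_ne_zero)).inv_tendsto_atTop

theorem one_add_sq_div_two_le_cosh (x : ℝ) : 1 + x ^ 2 / 2 ≤ Real.cosh x := by
  have h1 : Real.cosh x = 1 + 2 * Real.sinh (|x| / 2) ^ 2 := by
    rw [← Real.cosh_abs x, show |x| = 2 * (|x| / 2) by ring, Real.cosh_two_mul, Real.cosh_sq]
    ring_nf
  have h2 : |x| / 2 ≤ Real.sinh (|x| / 2) := Real.self_le_sinh_iff.2 (by positivity)
  have h3 : (|x| / 2) ^ 2 ≤ Real.sinh (|x| / 2) ^ 2 := pow_le_pow_left₀ (by positivity) h2 2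
  rw [div_pow, sq_abs] at h3
  linarith

theorem one_sub_tanh_sq (x : ℝ) : 1 - Real.tanh x ^ 2 = (1 / Real.cosh x) ^ 2 := by
  have := (Real.cosh_pos x).ne'
  rw [Real.tanh_eq_sinh_div_cosh]
  field_simp
  linarith [Real.cosh_sq x]

theorem one_sub_tanh_sq_nonneg (x : ℝ) : 0 ≤ 1 - Real.tanh x ^ 2 := by
  rw [one_sub_tanh_sq]
  positivity

theorem one_add_abs_mul_one_sub_tanh_sq_le (x : ℝ) :
    (1 + |x|) * (1 - Real.tanh x ^ 2) ≤ 4 * (1 + x ^ 2)⁻¹ := by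
  have hc := one_add_sq_div_two_le_cosh x
  have hp := Real.cosh_pos x
  have h1 : 1 + |x| ≤ 2 * Real.cosh x := by
    nlinarith [sq_nonneg (|x| - 1), sq_abs x, abs_nonneg x]
  have h2 : 1 + x ^ 2 ≤ 2 * Real.cosh x := by linarith
  have h3 : (1 + |x|) * (1 + x ^ 2) ≤ (2 * Real.cosh x) * (2 * Real.cosh x) := by gcongr
  rw [one_sub_tanh_sq, div_pow, one_pow, mul_one_div, ← div_eq_mul_inv,
    div_le_div_iff₀ (by positivity) (by positivity)]
  linarith

theorem one_sub_tanh_sq_le (x : ℝ) : 1 - Real.tanh x ^ 2 ≤ 4 * (1 + x ^ 2)⁻¹ :=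
  le_trans (by nlinarith [abs_nonneg x, one_sub_tanh_sq_nonneg x])
    (one_add_abs_mul_one_sub_tanh_sq_le x)

theorem hasDerivAt_tanh (x : ℝ) : HasDerivAt Real.tanh (1 - Real.tanh x ^ 2) x := by
  have h := (Real.hasDerivAt_sinh x).div (Real.hasDerivAt_cosh x) (Real.cosh_pos x).ne'
  have e : Real.tanh = Real.sinh / Real.cosh := by
    ext y
    exact Real.tanh_eq_sinh_div_cosh y
  rw [e]
  refine h.congr_deriv ?_
  have := (Real.cosh_pos x).ne'
  simp only [Pi.div_apply]
  field_simp

theorem continuous_tanh : Continuous Real.tanh :=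
  continuous_iff_continuousAt.2 fun x => (hasDerivAt_tanh x).continuousAt

theorem tanh_mem_Icc (x : ℝ) : Real.tanh x ∈ Set.Icc (-1 : ℝ) 1 := by
  have := one_sub_tanh_sq_nonneg x
  constructor <;> nlinarith

open Filter Topology in
theorem tendsto_tanh_atTop : Tendsto Real.tanh atTop (𝓝 1) := by
  have h : Tendsto (fun x : ℝ => 1 - 4 * (1 + x ^ 2)⁻¹) atTop (𝓝 1) := by
    simpa using (tendsto_inv_one_add_sq_atTop.const_mul 4).const_sub 1
  refine tendsto_of_tendsto_of_tendsto_of_le_of_le' h tendsto_const_nhds ?_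
    (Eventually.of_forall fun x => (tanh_mem_Icc x).2)
  filter_upwards [eventually_ge_atTop 0] with x hx
  have h0 : 0 ≤ Real.tanh x := by
    rw [Real.tanh_eq_sinh_div_cosh]
    exact div_nonneg (Real.sinh_nonneg_iff.2 hx) (Real.cosh_pos x).le
  nlinarith [one_sub_tanh_sq_le x, (tanh_mem_Icc x).2]

open Filter Topology in
theorem tendsto_tanh_atBot : Tendsto Real.tanh atBot (𝓝 (-1)) := by
  simpa [Function.comp_def] using (tendsto_tanh_atTop.comp tendsto_neg_atBot_atTop).neg

theorem integrable_one_add_abs_mul_one_sub_tanh_sq :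
    Integrable fun x : ℝ => (1 + |x|) * (1 - Real.tanh x ^ 2) := by
  have := continuous_tanh
  refine (integrable_inv_one_add_sq.const_mul 4).mono' (by fun_prop) (.of_forall fun x => ?_)
  rw [Real.norm_of_nonneg (mul_nonneg (by positivity) (one_sub_tanh_sq_nonneg x))]
  exact one_add_abs_mul_one_sub_tanh_sq_le x

theorem integrable_mul_one_sub_tanh_sq_mul {u p : ℝ → ℝ} (hu : Continuous u)
    (hu' : ∀ x, |u x| ≤ 1 + |x|) (hp : Continuous p) :
    Integrable fun x : ℝ => u x * ((1 - Real.tanh x ^ 2) * p (Real.tanh x)) := by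
  have := continuous_tanh
  obtain ⟨C, hC⟩ := (isCompact_Icc (a := (-1 : ℝ)) (b := 1)).exists_bound_of_continuousOn
    hp.continuousOn
  refine (integrable_one_add_abs_mul_one_sub_tanh_sq.mul_const C).mono' (by fun_prop)
    (.of_forall fun x => ?_)
  rw [norm_mul, norm_mul, Real.norm_of_nonneg (one_sub_tanh_sq_nonneg x), ← mul_assoc]
  have := one_sub_tanh_sq_nonneg x
  gcongr
  · exact hu' x
  · exact hC _ (tanh_mem_Icc x)

theorem integrable_one_sub_tanh_sq_mul {p : ℝ → ℝ} (hp : Continuous p) :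
    Integrable fun x : ℝ => (1 - Real.tanh x ^ 2) * p (Real.tanh x) := by
  simpa using integrable_mul_one_sub_tanh_sq_mul (u := fun _ => 1) continuous_const
    (fun x => by simp) hp

theorem integrable_id_mul_one_sub_tanh_sq_mul {p : ℝ → ℝ} (hp : Continuous p) :
    Integrable fun x : ℝ => x * ((1 - Real.tanh x ^ 2) * p (Real.tanh x)) :=
  integrable_mul_one_sub_tanh_sq_mul (u := fun x => x) continuous_id (fun x => by simp) hp

theorem integral_one_sub_tanh_sq_mul {P p : ℝ → ℝ} (hP : ∀ t, HasDerivAt P (p t) t)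
    (hp : Continuous p) :
    ∫ x : ℝ, (1 - Real.tanh x ^ 2) * p (Real.tanh x) = P 1 - P (-1) := by
  refine integral_of_hasDerivAt_of_tendsto (f := fun x => P (Real.tanh x)) (fun x => ?_)
    (integrable_one_sub_tanh_sq_mul hp)
    ((hP _).continuousAt.tendsto.comp tendsto_tanh_atBot)
    ((hP _).continuousAt.tendsto.comp tendsto_tanh_atTop)
  exact ((hP _).comp x (hasDerivAt_tanh x)).congr_deriv (mul_comm _ _)

theorem integral_id_mul_one_sub_tanh_sq_mul {r q : ℝ → ℝ} (hr : Continuous r)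
    (hq : ∀ t, HasDerivAt (fun t => (1 - t ^ 2) * r t) (q t) t) (hqc : Continuous q) :
    ∫ x : ℝ, x * ((1 - Real.tanh x ^ 2) * q (Real.tanh x)) =
      -∫ x : ℝ, (1 - Real.tanh x ^ 2) * r (Real.tanh x) := by
  have h := integral_mul_deriv_eq_deriv_mul_of_integrable (u := fun x : ℝ => x)
    (u' := fun _ => 1) (v := fun x => (1 - Real.tanh x ^ 2) * r (Real.tanh x))
    (v' := fun x => (1 - Real.tanh x ^ 2) * q (Real.tanh x))
    (fun x _ => hasDerivAt_id x)
    (fun x _ => ((hq _).comp x (hasDerivAt_tanh x)).congr_deriv (mul_comm _ _))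
    (integrable_id_mul_one_sub_tanh_sq_mul hqc)
    (by simpa [Pi.mul_def] using integrable_one_sub_tanh_sq_mul hr)
    (integrable_id_mul_one_sub_tanh_sq_mul hr)
  simpa using h

theorem hasDerivAt_comp_tanh_div {P : ℝ → ℝ} {p b x : ℝ}
    (hP : HasDerivAt P p (Real.tanh (x / b))) :
    HasDerivAt (fun x => P (Real.tanh (x / b))) (p * ((1 - Real.tanh (x / b) ^ 2) / b)) x := by
  have h := (hasDerivAt_tanh (x / b)).comp x ((hasDerivAt_id x).div_const b)
  exact (hP.comp x h).congr_deriv (by ring)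

theorem stmt_10 (a : ℝ) (ha : a < 0) (φ φa : ℝ → ℝ)
    (hφ : φ = fun x => -(3/2) * (1 / Real.cosh (x / (2 * Real.sqrt (-a))))^2)
    (hφa : φa = fun x => (3 * x / (4 * (-a) ^ ((3:ℝ)/2)))
        * (1 / Real.cosh (x / (2 * Real.sqrt (-a))))^2
        * Real.tanh (x / (2 * Real.sqrt (-a)))) :
    (∫ x : ℝ, (φ x)^2) = 6 * Real.sqrt (-a) ∧
    (∫ x : ℝ, (deriv φ x)^2) = 6 / (5 * Real.sqrt (-a)) ∧
    (∫ x : ℝ, (deriv (deriv φ) x)^2) = 6 / (7 * (-a) ^ ((3:ℝ)/2)) ∧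
    (∫ x : ℝ, φ x * deriv (deriv φ) x) = -6 / (5 * Real.sqrt (-a)) ∧
    (∫ x : ℝ, φa x * φ x) = -3 / (2 * Real.sqrt (-a)) ∧
    (∫ x : ℝ, φa x * deriv (deriv φ) x) = -3 / (10 * (-a) ^ ((3:ℝ)/2)) := by
  have hs : 0 < Real.sqrt (-a) := Real.sqrt_pos.2 (by linarith)
  have hpow : (-a) ^ ((3:ℝ)/2) = Real.sqrt (-a) ^ 3 := by
    rw [Real.sqrt_eq_rpow, ← Real.rpow_natCast, ← Real.rpow_mul (by linarith)]
    norm_num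
  rw [hpow] at hφa ⊢
  generalize Real.sqrt (-a) = s at hs hφ hφa ⊢
  have hφT : φ = fun x => -(3/2) * (1 - Real.tanh (x / (2 * s)) ^ 2) := by
    simp only [hφ, one_sub_tanh_sq]
  have hφaT : φa = fun x => (3 * x / (4 * s ^ 3)) * (1 - Real.tanh (x / (2 * s)) ^ 2)
      * Real.tanh (x / (2 * s)) := by
    simp only [hφa, one_sub_tanh_sq]
  have hd1 : deriv φ = fun x =>
      3 / (2 * s) * ((1 - Real.tanh (x / (2 * s)) ^ 2) * Real.tanh (x / (2 * s))) := by
    ext x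
    rw [hφT]
    refine ((hasDerivAt_comp_tanh_div (P := fun t => -(3/2) * (1 - t ^ 2))
      (((hasDerivAt_pow 2 _).const_sub 1).const_mul _)).congr_deriv ?_).deriv
    field_simp
    ring
  have hd2 : deriv (deriv φ) = fun x =>
      3 / (4 * s ^ 2) * ((1 - Real.tanh (x / (2 * s)) ^ 2) *
        (1 - 3 * Real.tanh (x / (2 * s)) ^ 2)) := by
    ext x
    rw [hd1]
    refine ((hasDerivAt_comp_tanh_div (P := fun t => 3 / (2 * s) * ((1 - t ^ 2) * t))
      ((((hasDerivAt_pow 2 _).const_sub 1).mul (hasDerivAt_id _)).const_mul _)).congr_deriv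
        ?_).deriv
    field_simp
    ring
  have key (c : ℝ) (g : ℝ → ℝ) : ∫ x, c * g (x / (2 * s)) = c * (2 * s * ∫ y, g y) := by
    rw [integral_const_mul, Measure.integral_comp_div, abs_of_pos (by positivity), smul_eq_mul]
  have poly (c₀ c₂ c₄ c₆ : ℝ) : ∫ x, (1 - Real.tanh x ^ 2) *
      (c₀ + c₂ * Real.tanh x ^ 2 + c₄ * Real.tanh x ^ 4 + c₆ * Real.tanh x ^ 6) =
      2 * (c₀ + c₂ / 3 + c₄ / 5 + c₆ / 7) := by
    rw [integral_one_sub_tanh_sq_mul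
      (P := fun t => c₀ * t + c₂ / 3 * t ^ 3 + c₄ / 5 * t ^ 5 + c₆ / 7 * t ^ 7)
      (p := fun t => c₀ + c₂ * t ^ 2 + c₄ * t ^ 4 + c₆ * t ^ 6) (fun t => ?_) (by fun_prop)]
    · ring
    · refine (((((hasDerivAt_id t).const_mul c₀).add ((hasDerivAt_pow 3 t).const_mul _)).add
        ((hasDerivAt_pow 5 t).const_mul _)).add
        ((hasDerivAt_pow 7 t).const_mul _)).congr_deriv ?_
      norm_num
      ring
  have moment₁ : ∫ x, x * ((1 - Real.tanh x ^ 2) * ((1 - Real.tanh x ^ 2) * Real.tanh x)) =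
      1 / 3 := by
    rw [integral_id_mul_one_sub_tanh_sq_mul (r := fun t => -(1/4) * (1 - t ^ 2))
      (q := fun t => (1 - t ^ 2) * t) (by fun_prop) (fun t => ?_) (by fun_prop)]
    · have h := poly (-(1/4)) (1/4) 0 0
      rw [integral_congr_ae (.of_forall fun x => ?_), h]
      · norm_num
      · ring
    · refine (((hasDerivAt_pow 2 t).const_sub 1).mul
        (((hasDerivAt_pow 2 t).const_sub 1).const_mul (-(1/4)))).congr_deriv ?_
      norm_num
      ring
  have moment₂ : ∫ x, x * ((1 - Real.tanh x ^ 2) *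
      ((1 - Real.tanh x ^ 2) * Real.tanh x * (1 - 3 * Real.tanh x ^ 2))) = -(2 / 15) := by
    rw [integral_id_mul_one_sub_tanh_sq_mul (r := fun t => 1/2 * ((1 - t ^ 2) * t ^ 2))
      (q := fun t => (1 - t ^ 2) * t * (1 - 3 * t ^ 2)) (by fun_prop) (fun t => ?_) (by fun_prop)]
    · have h := poly 0 (1/2) (-(1/2)) 0
      rw [integral_congr_ae (.of_forall fun x => ?_), h]
      · norm_num
      · ring
    · refine (((hasDerivAt_pow 2 t).const_sub 1).mul
        ((((hasDerivAt_pow 2 t).const_sub 1).mul (hasDerivAt_pow 2 t)).const_mul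
          (1/2))).congr_deriv ?_
      norm_num
      ring
  rw [hd2, hd1, hφT, hφaT]
  refine ⟨?_, ?_, ?_, ?_, ?_, ?_⟩
  · have h := key (9/4) fun y => (1 - Real.tanh y ^ 2) *
      (1 + (-1) * Real.tanh y ^ 2 + 0 * Real.tanh y ^ 4 + 0 * Real.tanh y ^ 6)
    rw [poly] at h
    rw [integral_congr_ae (.of_forall fun x => ?_), h]
    · ring
    · dsimp only
      ring
  · have h := key (9 / (4 * s ^ 2)) fun y => (1 - Real.tanh y ^ 2) *
      (0 + 1 * Real.tanh y ^ 2 + (-1) * Real.tanh y ^ 4 + 0 * Real.tanh y ^ 6)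
    rw [poly] at h
    rw [integral_congr_ae (.of_forall fun x => ?_), h]
    · field_simp
      norm_num
    · dsimp only
      ring
  · have h := key (9 / (16 * s ^ 4)) fun y => (1 - Real.tanh y ^ 2) *
      (1 + (-7) * Real.tanh y ^ 2 + 15 * Real.tanh y ^ 4 + (-9) * Real.tanh y ^ 6)
    rw [poly] at h
    rw [integral_congr_ae (.of_forall fun x => ?_), h]
    · field_simp
      norm_num
    · dsimp only
      ring
  · have h := key (-(9 / (8 * s ^ 2))) fun y => (1 - Real.tanh y ^ 2) *
      (1 + (-4) * Real.tanh y ^ 2 + 3 * Real.tanh y ^ 4 + 0 * Real.tanh y ^ 6)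
    rw [poly] at h
    rw [integral_congr_ae (.of_forall fun x => ?_), h]
    · field_simp
      norm_num
    · dsimp only
      ring
  · have h := key (-(9 / (4 * s ^ 2))) fun y =>
      y * ((1 - Real.tanh y ^ 2) * ((1 - Real.tanh y ^ 2) * Real.tanh y))
    rw [moment₁] at h
    rw [integral_congr_ae (.of_forall fun x => ?_), h]
    · field_simp
      norm_num
    · dsimp only
      field_simp
      ring
  · have h := key (9 / (8 * s ^ 4)) fun y => y * ((1 - Real.tanh y ^ 2) *
      ((1 - Real.tanh y ^ 2) * Real.tanh y * (1 - 3 * Real.tanh y ^ 2)))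
    rw [moment₂] at h
    rw [integral_congr_ae (.of_forall fun x => ?_), h]
    · field_simp
      norm_num
    · dsimp only
      field_simp
      ring
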